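/- arXiv:2203.01354 — 2 statements merged into one kernel-verified Lean document; each statement's English description precedes it below -/
import Mathlib

section
/- On V ⊗ V ⊗ V the identity Q_q^{(12)} ∘ Q_q^{(23)} ∘ Q_q^{(12)} = Q_q^{(12)} holds. -/
open scoped BigOperators

noncomputable section

/-- The index set `I = {-r, …, -1, 1, …, r}` as a subtype of `ℤ`. -/
abbrev SIdx (r : ℕ) : Type := {i : ℤ // i ∈ (Finset.Icc (-(r : ℤ)) (r : ℤ)).erase 0}

instance (r : ℕ) : Neg (SIdx r) :=
  ⟨fun i => ⟨-i.1, by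
    obtain ⟨h1, h2⟩ := Finset.mem_erase.mp i.2
    rw [Finset.mem_Icc] at h2
    exact Finset.mem_erase.mpr ⟨neg_ne_zero.mpr h1, Finset.mem_Icc.mpr (by omega)⟩⟩⟩

/-- The sign `ε_i`: `1` for `i > 0` and `-1` for `i < 0`, as an element of `K`. -/
def sgn (K : Type*) [Field K] {r : ℕ} (i : SIdx r) : K := if 0 < i.1 then 1 else -1

/-- A symplectic parameter family `q = (q_{ij}, q_i)`: nonzero scalars with
`q_{ij} = q_{ji}⁻¹`, `q_{ii} = 1`, `q_{-i} = q_i⁻¹` and `q_{-i,j} = q_{ij}⁻¹ q_j²`. -/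
structure SympParam (K : Type*) [Field K] (r : ℕ) where
  qm : SIdx r → SIdx r → K
  qv : SIdx r → K
  qm_ne : ∀ i j, qm i j ≠ 0
  qv_ne : ∀ i, qv i ≠ 0
  qm_symm : ∀ i j, qm i j = (qm j i)⁻¹
  qm_diag : ∀ i, qm i i = 1
  qv_neg : ∀ i, qv (-i) = (qv i)⁻¹
  qm_neg : ∀ i j, qm (-i) j = (qm i j)⁻¹ * (qv j) ^ 2

variable {K : Type*} [Field K] [CharZero K] {r : ℕ}

/-- The operator `P_q` on `V ⊗ V`, where `V = SIdx r → K` and `V ⊗ V` is realized as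
`(SIdx r × SIdx r) → K` with basis vector `e l ⊗ e m = Pi.single (l, m) 1`.  It sends
`e l ⊗ e m ↦ q_{lm} • (e m ⊗ e l)`. -/
def Pq (q : SympParam K r) : Module.End K (SIdx r × SIdx r → K) where
  toFun f := fun p => q.qm p.2 p.1 * f (p.2, p.1)
  map_add' f g := by funext p; simp [mul_add]
  map_smul' c f := by funext p; simp [smul_eq_mul]; ring

/-- The operator `Q_q` on `V ⊗ V`: it sends
`e l ⊗ e m ↦ δ_{m,-l} ε_l q_l⁻¹ • ∑ i, ε_i q_i • (e i ⊗ e (-i))`. -/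
def Qq (q : SympParam K r) : Module.End K (SIdx r × SIdx r → K) where
  toFun f := fun p =>
    if p.2 = -p.1 then
      sgn K p.1 * q.qv p.1 * ∑ l : SIdx r, sgn K l * (q.qv l)⁻¹ * f (l, -l)
    else 0
  map_add' f g := by
    funext p
    by_cases h : p.2 = -p.1 <;> simp [h, mul_add, Finset.sum_add_distrib]
  map_smul' c f := by
    funext p
    by_cases h : p.2 = -p.1 <;>
      simp only [h, if_true, if_false, Pi.smul_apply, smul_eq_mul, RingHom.id_apply,
        Finset.mul_sum, mul_zero]
    · exact Finset.sum_congr rfl fun l _ => by ring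

/-- The operator `T^{(a,b)}` on `V^{⊗k} = (Fin k → SIdx r) → K` (for `a ≠ b`): it acts as
`T` on the `a`-th and `b`-th tensor factors and as the identity on all other factors. -/
def liftAB {k : ℕ} (T : Module.End K (SIdx r × SIdx r → K)) (a b : Fin k) :
    Module.End K ((Fin k → SIdx r) → K) where
  toFun f := fun v => ∑ l : SIdx r, ∑ m : SIdx r,
    T (Pi.single (l, m) 1) (v a, v b) * f (Function.update (Function.update v a l) b m)
  map_add' f g := by
    funext v
    simp [mul_add, Finset.sum_add_distrib]
  map_smul' c f := by
    funext v
    simp only [Pi.smul_apply, smul_eq_mul, RingHom.id_apply, Finset.mul_sum]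
    congr 1; funext l; congr 1; funext m; ring

theorem SIdx.neg_neg (i : SIdx r) : -(-i) = i :=
  Subtype.ext (_root_.neg_neg i.1)

theorem sgn_neg {F : Type*} [Field F] (i : SIdx r) : sgn F (-i) = -sgn F i := by
  have h0 : i.1 ≠ 0 := (Finset.mem_erase.mp i.2).1
  have hi : (-i).1 = -i.1 := rfl
  unfold sgn
  rw [hi]
  split_ifs <;> first | omega | simp

theorem sgn_mul_self {F : Type*} [Field F] (i : SIdx r) : sgn F i * sgn F i = 1 := by
  unfold sgn
  split_ifs <;> simp

/-- The action of `Q_q^{(a,b)}` in coordinates. -/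
theorem liftAB_Qq_apply {k : ℕ} (q : SympParam K r) (a b : Fin k)
    (f : (Fin k → SIdx r) → K) (v : Fin k → SIdx r) :
    liftAB (Qq q) a b f v =
      if v b = -v a then
        sgn K (v a) * q.qv (v a) * ∑ l : SIdx r, sgn K l * (q.qv l)⁻¹ *
          f (Function.update (Function.update v a l) b (-l))
      else 0 := by
  have hQ (l m : SIdx r) : Qq q (Pi.single (l, m) 1) (v a, v b) =
      if v b = -v a then
        sgn K (v a) * q.qv (v a) * (if m = -l then sgn K l * (q.qv l)⁻¹ else 0)
      else 0 := by
    change (if v b = -v a then sgn K (v a) * q.qv (v a) * ∑ x : SIdx r, sgn K x * (q.qv x)⁻¹ *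
      (Pi.single (l, m) (1 : K) : SIdx r × SIdx r → K) (x, -x) else 0) = _
    congr 2
    rw [Finset.sum_eq_single l]
    · by_cases h : m = -l
      · subst h; simp
      · simp [h, Ne.symm h]
    · intro x _ hx
      simp [hx]
    · simp
  change ∑ l : SIdx r, ∑ m : SIdx r, Qq q (Pi.single (l, m) 1) (v a, v b) *
    f (Function.update (Function.update v a l) b m) = _
  simp only [hQ]
  split_ifs with h
  · rw [Finset.mul_sum]
    refine Finset.sum_congr rfl fun l _ => ?_
    rw [Finset.sum_eq_single (-l)]
    · simp [mul_assoc]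
    · intro m _ hm
      simp [hm]
    · simp
  · simp

/-- `Q_q^{(12)}` on pure coordinates. -/
theorem liftAB_Qq_zero_one_apply (q : SympParam K r) (f : (Fin 3 → SIdx r) → K)
    (x y z : SIdx r) :
    liftAB (Qq q) 0 1 f ![x, y, z] =
      if y = -x then
        sgn K x * q.qv x * ∑ l : SIdx r, sgn K l * (q.qv l)⁻¹ * f ![l, -l, z]
      else 0 := by
  have hu (l : SIdx r) :
      Function.update (Function.update ![x, y, z] 0 l) 1 (-l) = ![l, -l, z] := by
    ext i; fin_cases i <;> rfl
  rw [liftAB_Qq_apply]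
  simp only [hu]
  rfl

/-- `Q_q^{(23)}` on pure coordinates. -/
theorem liftAB_Qq_one_two_apply (q : SympParam K r) (f : (Fin 3 → SIdx r) → K)
    (x y z : SIdx r) :
    liftAB (Qq q) 1 2 f ![x, y, z] =
      if z = -y then
        sgn K y * q.qv y * ∑ l : SIdx r, sgn K l * (q.qv l)⁻¹ * f ![x, l, -l]
      else 0 := by
  have hu (l : SIdx r) :
      Function.update (Function.update ![x, y, z] 1 l) 2 (-l) = ![x, l, -l] := by
    ext i; fin_cases i <;> rfl
  rw [liftAB_Qq_apply]
  simp only [hu]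
  rfl

/-- `Q_q^{(12)} ∘ Q_q^{(23)} ∘ Q_q^{(12)} = Q_q^{(12)}` on `V ⊗ V ⊗ V`. -/
theorem Qq_121 (hr : 1 ≤ r) (q : SympParam K r) :
    liftAB (k := 3) (Qq q) 0 1 ∘ₗ liftAB (Qq q) 1 2 ∘ₗ liftAB (Qq q) 0 1
      = liftAB (k := 3) (Qq q) 0 1 := by
  refine LinearMap.ext fun f => funext fun v => ?_
  obtain ⟨x, y, z, rfl⟩ : ∃ x y z, v = ![x, y, z] :=
    ⟨v 0, v 1, v 2, by ext i; fin_cases i <;> rfl⟩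
  simp only [LinearMap.comp_apply]
  rw [liftAB_Qq_zero_one_apply, liftAB_Qq_zero_one_apply]
  split_ifs with hxy
  swap
  · rfl
  congr 1
  set F := ∑ l : SIdx r, sgn K l * (q.qv l)⁻¹ * f ![l, -l, z] with hF
  rw [Finset.sum_eq_single z]
  · rw [liftAB_Qq_one_two_apply, if_pos (SIdx.neg_neg z).symm, Finset.sum_eq_single (-z)]
    · rw [liftAB_Qq_zero_one_apply, if_pos rfl, SIdx.neg_neg, ← hF, sgn_neg, q.qv_neg]
      have hq := q.qv_ne z
      have hs := sgn_mul_self (F := K) z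
      field_simp
      linear_combination F * (sgn K z * sgn K z + 1) * hs
    · intro l _ hl
      rw [liftAB_Qq_zero_one_apply, if_neg hl, mul_zero]
    · simp
  · intro l _ hl
    rw [liftAB_Qq_one_two_apply, SIdx.neg_neg, if_neg (Ne.symm hl), mul_zero]
  · simp
end
end

section
/- Let k ≥ 1 and let t be an integer with 0 ≤ 2t ≤ k. Let ρ_q : S_k → GL(V^{⊗k}) be the group homomorphism with ρ_q(σ_a) = −P_q^{(a,a+1)} for every adjacent transposition σ_a, and set A_q = (1/k!) Σ_{σ∈S_k} ρ_q(σ). Then the trace over V^{⊗k} of the operator A_q ∘ Q_q^{(1,2)} ∘ Q_q^{(3,4)} ∘ ⋯ ∘ Q_q^{(2t−1,2t)} does not depend on the symplectic parameter family q; in particular it equals its value at the trivial family q_{ij} = q_i = 1. -/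
open scoped BigOperators

noncomputable section

variable {K : Type*} [Field K] [CharZero K] {r : ℕ}

section Gauge

variable {F : Type*} [Field F]

namespace SympParam

/-- The trivial symplectic parameter family, `q_{ij} = q_i = 1`. -/
def trivial (F : Type*) [Field F] (r : ℕ) : SympParam F r where
  qm _ _ := 1
  qv _ := 1
  qm_ne _ _ := one_ne_zero
  qv_ne _ := one_ne_zero
  qm_symm _ _ := by simp
  qm_diag _ := rfl
  qv_neg _ := by simp
  qm_neg _ _ := by simp

/-- The normalized parameters `b_{ij} = q_{ij} q_i q_j⁻¹`. -/
def bm (q : SympParam F r) (x y : SIdx r) : F := q.qm x y * q.qv x * (q.qv y)⁻¹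

theorem bm_ne_zero (q : SympParam F r) (x y : SIdx r) : q.bm x y ≠ 0 :=
  mul_ne_zero (mul_ne_zero (q.qm_ne x y) (q.qv_ne x)) (inv_ne_zero (q.qv_ne y))

theorem bm_symm (q : SympParam F r) (x y : SIdx r) : q.bm x y = (q.bm y x)⁻¹ := by
  have := q.qv_ne x
  have := q.qv_ne y
  have := q.qm_ne y x
  rw [bm, bm, q.qm_symm x y]
  field_simp

theorem bm_neg_left (q : SympParam F r) (x y : SIdx r) : q.bm (-x) y = (q.bm x y)⁻¹ := by
  have := q.qv_ne x
  have := q.qv_ne y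
  have := q.qm_ne x y
  rw [bm, bm, q.qm_neg, q.qv_neg]
  field_simp

theorem bm_neg_right (q : SympParam F r) (x y : SIdx r) : q.bm x (-y) = (q.bm x y)⁻¹ := by
  rw [bm_symm, bm_neg_left, ← bm_symm]

theorem bm_self (q : SympParam F r) (x : SIdx r) : q.bm x x = 1 := by
  have := q.qv_ne x
  rw [bm, q.qm_diag]
  field_simp

theorem bm_of_abs_eq (q : SympParam F r) {x y : SIdx r} (h : |x.1| = |y.1|) : q.bm x y = 1 := by
  rcases abs_eq_abs.mp h with h | h
  · rw [Subtype.ext h, bm_self]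
  · rw [show x = -y from Subtype.ext h, bm_neg_left, bm_self, inv_one]

/-- The part of `bm` supported on the pairs with `|x| > |y|`. -/
def halfBm (q : SympParam F r) (x y : SIdx r) : F := if |y.1| < |x.1| then q.bm x y else 1

theorem halfBm_ne_zero (q : SympParam F r) (x y : SIdx r) : q.halfBm x y ≠ 0 := by
  unfold halfBm
  split_ifs
  · exact q.bm_ne_zero x y
  · exact one_ne_zero

theorem abs_neg_val (x : SIdx r) : |(-x).1| = |x.1| := abs_neg x.1

theorem halfBm_neg_left (q : SympParam F r) (x y : SIdx r) :
    q.halfBm (-x) y = (q.halfBm x y)⁻¹ := by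
  unfold halfBm
  rw [abs_neg_val, bm_neg_left]
  split_ifs <;> simp

theorem halfBm_neg_right (q : SympParam F r) (x y : SIdx r) :
    q.halfBm x (-y) = (q.halfBm x y)⁻¹ := by
  unfold halfBm
  rw [abs_neg_val, bm_neg_right]
  split_ifs <;> simp

theorem halfBm_self (q : SympParam F r) (x : SIdx r) : q.halfBm x x = 1 := by
  simp [halfBm]

theorem halfBm_comm (q : SympParam F r) (x y : SIdx r) :
    q.halfBm y x = q.bm y x * q.halfBm x y := by
  unfold halfBm
  rcases lt_trichotomy |x.1| |y.1| with h | h | h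
  · rw [if_pos h, if_neg h.not_gt, mul_one]
  · rw [if_neg h.not_lt, if_neg h.not_gt, q.bm_of_abs_eq h.symm, mul_one]
  · rw [if_neg h.not_gt, if_pos h, q.bm_symm y x, inv_mul_cancel₀ (q.bm_ne_zero x y)]

/-- The product of `halfBm` over all pairs of positions. -/
def pairProd {k : ℕ} (q : SympParam F r) (v : Fin k → SIdx r) : F :=
  ∏ i, ∏ j, if i < j then q.halfBm (v i) (v j) else 1

/-- The diagonal entries of the operator conjugating the structure attached to `q` into the
one attached to the trivial family. -/
def gauge {k : ℕ} (q : SympParam F r) (v : Fin k → SIdx r) : F :=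
  q.pairProd v * ∏ i, q.qv (v i) ^ (i : ℕ)

theorem gauge_ne_zero {k : ℕ} (q : SympParam F r) (v : Fin k → SIdx r) : q.gauge v ≠ 0 := by
  refine mul_ne_zero (Finset.prod_ne_zero_iff.mpr fun i _ => Finset.prod_ne_zero_iff.mpr
    fun j _ => ?_) (Finset.prod_ne_zero_iff.mpr fun i _ => pow_ne_zero _ (q.qv_ne _))
  split_ifs
  · exact q.halfBm_ne_zero _ _
  · exact one_ne_zero

end SympParam

theorem prod_eq_mul_prod_of_pair {ι M : Type*} [Fintype ι] [DecidableEq ι] [CommMonoid M]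
    {a b : ι} (hab : a ≠ b) (c : M) (f g : ι → M) (hfg : ∀ i, i ≠ a → i ≠ b → f i = g i)
    (h : f a * f b = c * (g a * g b)) : ∏ i, f i = c * ∏ i, g i := by
  have hb : b ∈ Finset.univ.erase a := Finset.mem_erase.mpr ⟨hab.symm, Finset.mem_univ b⟩
  rw [← Finset.mul_prod_erase _ f (Finset.mem_univ a), ← Finset.mul_prod_erase _ f hb,
    ← Finset.mul_prod_erase _ g (Finset.mem_univ a), ← Finset.mul_prod_erase _ g hb,
    ← mul_assoc, ← mul_assoc (g a), ← mul_assoc c, h]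
  congr 1
  refine Finset.prod_congr rfl fun i hi => ?_
  simp only [Finset.mem_erase] at hi
  exact hfg i hi.2.1 hi.1

namespace SympParam

variable {k : ℕ} {a b : Fin k}

theorem pairProd_comp_swap (q : SympParam F r) (hab : (b : ℕ) = a + 1) (v : Fin k → SIdx r) :
    q.pairProd (v ∘ Equiv.swap a b) = q.bm (v b) (v a) * q.pairProd v := by
  set s := Equiv.swap a b
  have hne : a ≠ b := fun h => by simp [h] at hab
  have reindex : q.pairProd (v ∘ s) =
      ∏ p : Fin k × Fin k, if s p.1 < s p.2 then q.halfBm (v p.1) (v p.2) else 1 := by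
    rw [pairProd, ← Fintype.prod_prod_type', ← Equiv.prod_comp (s.prodCongr s)]
    simp [s]
  have hv : q.pairProd v =
      ∏ p : Fin k × Fin k, if p.1 < p.2 then q.halfBm (v p.1) (v p.2) else 1 := by
    rw [pairProd, ← Fintype.prod_prod_type']
  rw [reindex, hv]
  refine prod_eq_mul_prod_of_pair (a := (a, b)) (b := (b, a)) (by simp [hne]) _ _ _ ?_ ?_
  · rintro ⟨i, j⟩ h1 h2
    have key : s i < s j ↔ i < j := by
      simp only [ne_eq, Prod.mk.injEq, not_and] at h1 h2
      simp only [s, Equiv.swap_apply_def]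
      simp only [Fin.ext_iff, Fin.lt_def] at *
      split_ifs <;> omega
    simp only [key]
  · have hlt : a < b := by rw [Fin.lt_def]; omega
    simp [s, hlt, hlt.not_gt, q.halfBm_comm (v a) (v b)]

theorem gauge_comp_swap (q : SympParam F r) (hab : (b : ℕ) = a + 1) (v : Fin k → SIdx r) :
    q.gauge (v ∘ Equiv.swap a b) = q.gauge v * q.qm (v b) (v a) := by
  have hne : a ≠ b := fun h => by simp [h] at hab
  have ha := q.qv_ne (v a)
  have hb := q.qv_ne (v b)
  have hpow : ∏ i, q.qv ((v ∘ Equiv.swap a b) i) ^ (i : ℕ) =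
      (q.qv (v a) * (q.qv (v b))⁻¹) * ∏ i, q.qv (v i) ^ (i : ℕ) := by
    refine prod_eq_mul_prod_of_pair hne _ _ _ (fun i h1 h2 => ?_) ?_
    · simp [Equiv.swap_apply_of_ne_of_ne h1 h2]
    · simp only [Function.comp_apply, Equiv.swap_apply_left, Equiv.swap_apply_right, hab]
      field_simp
      ring
  rw [gauge, gauge, hpow, q.pairProd_comp_swap hab, bm]
  field_simp

theorem pairProd_eq_of_neutral_pair (q : SympParam F r) (hab : (b : ℕ) = a + 1)
    {v w : Fin k → SIdx r} (hv : v b = -v a) (hw : w b = -w a)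
    (h : ∀ i, i ≠ a → i ≠ b → v i = w i) : q.pairProd v = q.pairProd w := by
  have hne : a ≠ b := fun h => by simp [h] at hab
  have hrow : ∀ u : Fin k → SIdx r, u b = -u a →
      (∏ j, if a < j then q.halfBm (u a) (u j) else 1) *
        (∏ j, if b < j then q.halfBm (u b) (u j) else 1) = 1 := by
    intro u hu
    rw [← Finset.prod_mul_distrib]
    refine Finset.prod_eq_one fun j _ => ?_
    rcases eq_or_ne j b with rfl | hj
    · simp [hu, halfBm_neg_right, halfBm_self]
    · have key : b < j ↔ a < j := by
        simp only [ne_eq, Fin.ext_iff, Fin.lt_def] at *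
        omega
      simp only [key, hu, halfBm_neg_left]
      split_ifs
      · exact mul_inv_cancel₀ (q.halfBm_ne_zero _ _)
      · exact one_mul 1
  rw [pairProd, ← one_mul (q.pairProd w)]
  refine prod_eq_mul_prod_of_pair hne _ _ _ (fun i h1 h2 => ?_) ?_
  · rw [← one_mul (∏ j, if i < j then q.halfBm (w i) (w j) else 1)]
    refine prod_eq_mul_prod_of_pair hne _ _ _ (fun j h3 h4 => ?_) ?_
    · rw [h i h1 h2, h j h3 h4]
    · have key : i < b ↔ i < a := by
        simp only [ne_eq, Fin.ext_iff, Fin.lt_def] at *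
        omega
      simp only [key, hv, hw, halfBm_neg_right]
      split_ifs
      · rw [mul_inv_cancel₀ (q.halfBm_ne_zero _ _), mul_inv_cancel₀ (q.halfBm_ne_zero _ _), one_mul]
      · simp
  · rw [hrow v hv, hrow w hw, one_mul]

theorem gauge_of_neutral_pair (q : SympParam F r) (hab : (b : ℕ) = a + 1) {v w : Fin k → SIdx r} (hv : v b = -v a) (hw : w b = -w a)
    (h : ∀ i, i ≠ a → i ≠ b → v i = w i) :
    q.gauge v * q.qv (v a) = q.gauge w * q.qv (w a) := by
  have hne : a ≠ b := fun h => by simp [h] at hab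
  have hva := q.qv_ne (v a)
  have hwa := q.qv_ne (w a)
  have hpow : ∏ i, q.qv (v i) ^ (i : ℕ) =
      (q.qv (w a) * (q.qv (v a))⁻¹) * ∏ i, q.qv (w i) ^ (i : ℕ) := by
    refine prod_eq_mul_prod_of_pair hne _ _ _ (fun i h1 h2 => by rw [h i h1 h2]) ?_
    rw [hv, hw, q.qv_neg, q.qv_neg, hab, inv_pow, inv_pow]
    field_simp
    ring
  rw [gauge, gauge, hpow, q.pairProd_eq_of_neutral_pair hab hv hw h]
  field_simp

end SympParam

/-- The diagonal operator on `V^{⊗k}` with entries `q.gauge`. -/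
def gaugeUnit (q : SympParam F r) (k : ℕ) : (Module.End F ((Fin k → SIdx r) → F))ˣ :=
  Units.map (Algebra.lmul F ((Fin k → SIdx r) → F)).toMonoidHom
    { val := fun v => q.gauge v
      inv := fun v => (q.gauge v)⁻¹
      val_inv := funext fun v => mul_inv_cancel₀ (q.gauge_ne_zero v)
      inv_val := funext fun v => inv_mul_cancel₀ (q.gauge_ne_zero v) }

theorem gaugeUnit_conj_liftAB (q : SympParam F r) {k : ℕ} {a b : Fin k}
    {T T' : Module.End F (SIdx r × SIdx r → F)}
    (h : ∀ (v : Fin k → SIdx r) (l m : SIdx r),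
      q.gauge v * T (Pi.single (l, m) 1) (v a, v b) =
        T' (Pi.single (l, m) 1) (v a, v b) *
          q.gauge (Function.update (Function.update v a l) b m)) :
    (gaugeUnit q k : Module.End F ((Fin k → SIdx r) → F)) * liftAB T a b *
      ((gaugeUnit q k)⁻¹ : (Module.End F ((Fin k → SIdx r) → F))ˣ) = liftAB T' a b := by
  rw [Units.mul_inv_eq_iff_eq_mul]
  refine LinearMap.ext fun f => funext fun v => ?_
  change q.gauge v * (∑ l : SIdx r, ∑ m : SIdx r, _) =
    ∑ l : SIdx r, ∑ m : SIdx r, _ * (q.gauge _ * f _)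
  simp only [Finset.mul_sum, ← mul_assoc, h]

theorem gaugeUnit_conj_Pq (q : SympParam F r) {k : ℕ} {a b : Fin k} (hab : (b : ℕ) = a + 1) :
    (gaugeUnit q k : Module.End F ((Fin k → SIdx r) → F)) * liftAB (Pq q) a b *
      ((gaugeUnit q k)⁻¹ : (Module.End F ((Fin k → SIdx r) → F))ˣ) =
      liftAB (Pq (SympParam.trivial F r)) a b := by
  refine gaugeUnit_conj_liftAB q fun v l m => ?_
  change q.gauge v * (q.qm (v b) (v a) * _) = 1 * _ * _
  by_cases hlm : (v b, v a) = (l, m)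
  · obtain ⟨rfl, rfl⟩ := Prod.mk.inj hlm
    have hupd : Function.update (Function.update v a (v b)) b (v a) = v ∘ Equiv.swap a b := by
      funext i
      simp only [Function.update_apply, Function.comp_apply, Equiv.swap_apply_def]
      split_ifs <;> simp_all
    rw [hupd, q.gauge_comp_swap hab]
    simp
  · simp [Pi.single_eq_of_ne hlm]

theorem gaugeUnit_conj_eq_neg_Pq {k : ℕ} (q : SympParam F r)
    (ρ : Equiv.Perm (Fin k) →* (Module.End F ((Fin k → SIdx r) → F))ˣ) {a b : Fin k}
    (hab : (b : ℕ) = a + 1)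
    (hρ : (ρ (Equiv.swap a b) : Module.End F ((Fin k → SIdx r) → F)) = -liftAB (Pq q) a b) :
    (((MulAut.conj (gaugeUnit q k)).toMonoidHom.comp ρ) (Equiv.swap a b) :
      Module.End F ((Fin k → SIdx r) → F)) = -liftAB (Pq (SympParam.trivial F r)) a b := by
  change (gaugeUnit q k : Module.End F ((Fin k → SIdx r) → F)) * ρ (Equiv.swap a b) * _ = _
  rw [hρ, ← gaugeUnit_conj_Pq q hab]
  exact LinearMap.ext fun f => map_neg (gaugeUnit q k : Module.End F ((Fin k → SIdx r) → F)) _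

variable [CharZero F]

theorem Qq_single (q : SympParam F r) (l m x y : SIdx r) :
    Qq q (Pi.single (l, m) 1) (x, y) =
      if y = -x ∧ m = -l then sgn F x * q.qv x * (sgn F l * (q.qv l)⁻¹) else 0 := by
  change (if y = -x then sgn F x * q.qv x * ∑ i : SIdx r, sgn F i * (q.qv i)⁻¹ *
    (Pi.single (l, m) 1 : SIdx r × SIdx r → F) (i, -i) else 0) = _
  by_cases hy : y = -x
  · rw [if_pos hy, Finset.sum_eq_single l]
    · by_cases hm : m = -l
      · simp [hy, hm]
      · have : -l ≠ m := fun h => hm h.symm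
        simp [hm, this]
    · intro i _ hi
      have : ((i, -i) : SIdx r × SIdx r) ≠ (l, m) := fun h => hi (Prod.mk.inj h).1
      simp [Pi.single_eq_of_ne this]
    · simp
  · simp [hy]

theorem gaugeUnit_conj_Qq (q : SympParam F r) {k : ℕ} {a b : Fin k} (hab : (b : ℕ) = a + 1) :
    (gaugeUnit q k : Module.End F ((Fin k → SIdx r) → F)) * liftAB (Qq q) a b *
      ((gaugeUnit q k)⁻¹ : (Module.End F ((Fin k → SIdx r) → F))ˣ) =
      liftAB (Qq (SympParam.trivial F r)) a b := by
  refine gaugeUnit_conj_liftAB q fun v l m => ?_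
  rw [Qq_single, Qq_single]
  split_ifs with h
  · have hne : a ≠ b := fun h => by simp [h] at hab
    have hl := q.qv_ne l
    have key := q.gauge_of_neutral_pair hab (v := v)
      (w := Function.update (Function.update v a l) b m) h.1 (by simp [hne, h.2])
      (fun i h1 h2 => by simp [h1, h2])
    simp only [Function.update_of_ne hne, Function.update_self] at key
    simp only [SympParam.trivial, inv_one, mul_one]
    field_simp
    linear_combination (sgn F (v a) * sgn F l) * key
  · simp

theorem monoidHom_eq_of_adjacent_swap {k : ℕ} (hk : 1 ≤ k) {G : Type*} [Monoid G]
    {φ ψ : Equiv.Perm (Fin k) →* G}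
    (h : ∀ (a : ℕ) (h : a + 1 < k), φ (Equiv.swap ⟨a, by omega⟩ ⟨a + 1, h⟩) =
      ψ (Equiv.swap ⟨a, by omega⟩ ⟨a + 1, h⟩)) : φ = ψ := by
  obtain ⟨n, rfl⟩ : ∃ n, k = n + 1 := ⟨k - 1, by omega⟩
  refine MonoidHom.eq_of_eqOn_denseM (Equiv.Perm.mclosure_swap_castSucc_succ n) ?_
  rintro _ ⟨i, rfl⟩
  exact h i (by omega)

/-- Conjugating by `gaugeUnit q k` replaces the operator attached to `q` by one built from the
conjugated representation and the trivial family. -/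
theorem trace_eq_trace_gauge_conj {k t : ℕ} (h2t : 2 * t ≤ k) (q : SympParam F r)
    (ρ : Equiv.Perm (Fin k) →* (Module.End F ((Fin k → SIdx r) → F))ˣ) :
    LinearMap.trace F ((Fin k → SIdx r) → F)
      (((k.factorial : F)⁻¹ •
          ∑ σ : Equiv.Perm (Fin k), (ρ σ : Module.End F ((Fin k → SIdx r) → F))) *
        (List.ofFn fun p : Fin t => liftAB (Qq q)
          ⟨2 * p.1, by have := p.2; omega⟩ ⟨2 * p.1 + 1, by have := p.2; omega⟩).prod)
    = LinearMap.trace F ((Fin k → SIdx r) → F)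
      (((k.factorial : F)⁻¹ •
          ∑ σ : Equiv.Perm (Fin k), (((MulAut.conj (gaugeUnit q k)).toMonoidHom.comp ρ) σ :
            Module.End F ((Fin k → SIdx r) → F))) *
        (List.ofFn fun p : Fin t => liftAB (Qq (SympParam.trivial F r))
          ⟨2 * p.1, by have := p.2; omega⟩ ⟨2 * p.1 + 1, by have := p.2; omega⟩).prod) := by
  refine (LinearMap.trace_conj (R := F) _ (gaugeUnit q k)).symm.trans ?_
  set D := gaugeUnit q k
  let c : Module.End F ((Fin k → SIdx r) → F) →* Module.End F ((Fin k → SIdx r) → F) :=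
    { toFun := fun X => D * X * (D⁻¹ : (Module.End F ((Fin k → SIdx r) → F))ˣ)
      map_one' := by simp
      map_mul' := fun X Y => by simp [mul_assoc] }
  congr 1
  change c (_ * _) = _
  rw [map_mul, map_list_prod, List.map_ofFn]
  congr 1
  · change (D : Module.End F ((Fin k → SIdx r) → F)) * (_ • _) * _ = _
    simp only [mul_smul_comm, smul_mul_assoc, Finset.mul_sum, Finset.sum_mul]
    rfl
  · congr 2
    funext p
    exact gaugeUnit_conj_Qq q rfl

end Gauge

/-- let `ρ_q : S_k → GL(V^{⊗k})` be the homomorphism with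
`ρ_q(σ_a) = −P_q^{(a,a+1)}` and `A_q = (1/k!) ∑_σ ρ_q(σ)`.  The trace over `V^{⊗k}` of
`A_q ∘ Q_q^{(1,2)} ∘ Q_q^{(3,4)} ∘ ⋯ ∘ Q_q^{(2t−1,2t)}` does not depend on the symplectic
parameter family `q` (positions are numbered `0, …, k−1`, so the pairs are
`(2p, 2p+1)` for `p = 0, …, t−1`). -/
theorem trace_independent (hr : 1 ≤ r) (k t : ℕ) (hk : 1 ≤ k) (h2t : 2 * t ≤ k)
    (q q' : SympParam K r)
    (ρ ρ' : Equiv.Perm (Fin k) →* (Module.End K ((Fin k → SIdx r) → K))ˣ)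
    (hρ : ∀ (a : ℕ) (h : a + 1 < k),
      (ρ (Equiv.swap ⟨a, by omega⟩ ⟨a + 1, h⟩) : Module.End K ((Fin k → SIdx r) → K))
        = -liftAB (Pq q) ⟨a, by omega⟩ ⟨a + 1, h⟩)
    (hρ' : ∀ (a : ℕ) (h : a + 1 < k),
      (ρ' (Equiv.swap ⟨a, by omega⟩ ⟨a + 1, h⟩) : Module.End K ((Fin k → SIdx r) → K))
        = -liftAB (Pq q') ⟨a, by omega⟩ ⟨a + 1, h⟩) :
    LinearMap.trace K ((Fin k → SIdx r) → K)
      (((k.factorial : K)⁻¹ •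
          ∑ σ : Equiv.Perm (Fin k), (ρ σ : Module.End K ((Fin k → SIdx r) → K))) *
        (List.ofFn fun p : Fin t => liftAB (Qq q)
          ⟨2 * p.1, by have := p.2; omega⟩ ⟨2 * p.1 + 1, by have := p.2; omega⟩).prod)
    = LinearMap.trace K ((Fin k → SIdx r) → K)
      (((k.factorial : K)⁻¹ •
          ∑ σ : Equiv.Perm (Fin k), (ρ' σ : Module.End K ((Fin k → SIdx r) → K))) *
        (List.ofFn fun p : Fin t => liftAB (Qq q')
          ⟨2 * p.1, by have := p.2; omega⟩ ⟨2 * p.1 + 1, by have := p.2; omega⟩).prod) := by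
  rw [trace_eq_trace_gauge_conj h2t q ρ, trace_eq_trace_gauge_conj h2t q' ρ',
    monoidHom_eq_of_adjacent_swap hk (φ := (MulAut.conj (gaugeUnit q k)).toMonoidHom.comp ρ)
      (ψ := (MulAut.conj (gaugeUnit q' k)).toMonoidHom.comp ρ') fun a h => Units.ext ?_]
  rw [gaugeUnit_conj_eq_neg_Pq q ρ rfl (hρ a h), gaugeUnit_conj_eq_neg_Pq q' ρ' rfl (hρ' a h)]
end
end
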